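/- Let K be a descriptive compact Hausdorff space which is a continuous image of a Radon–Nikodym compact space (i.e., there exist a Radon–Nikodym compact space K' and a continuous surjection K' → K). Then C(K) admits a norm, equivalent to the supremum norm, which is locally uniformly convex. -/

import Mathlib

open Filter Topology

/-- `d` is a metric on `K` (as a bare distance function). -/
structure IsMetricOn (K : Type*) (d : K → K → ℝ) : Prop where
  self_eq_zero : ∀ x, d x x = 0
  eq_of_dist_eq_zero : ∀ x y, d x y = 0 → x = y
  symm : ∀ x y, d x y = d y x
  triangle : ∀ x y z, d x z ≤ d x y + d y z

/-- The topology `T_d` induced by the distance function `d`: generated by open balls. -/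
def metricTopology {K : Type*} (d : K → K → ℝ) : TopologicalSpace K :=
  TopologicalSpace.generateFrom {S | ∃ (x : K) (ε : ℝ), 0 < ε ∧ S = {y | d x y < ε}}

/-- Property `P(d,T)`: there is a sequence `(B_n)` of subsets of `K` such that the
topology generated by `T ∪ {B_n : n ∈ ℕ}` is finer than the metric topology `T_d`. -/
def PropertyP {K : Type*} (T : TopologicalSpace K) (d : K → K → ℝ) : Prop :=
  ∃ B : ℕ → Set K,
    TopologicalSpace.generateFrom ({U | T.IsOpen U} ∪ Set.range B) ≤ metricTopology d

/-- The LUR hypothesis and conclusion at a point `x`, for a gauge `N`. -/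
def LURAt {Z : Type*} [AddCommGroup Z] [Module ℝ Z] (N : Z → ℝ) (x : Z) : Prop :=
  ∀ xr : ℕ → Z,
    Tendsto (fun r => (1/2) * N x ^ 2 + (1/2) * N (xr r) ^ 2
        - N ((1/2 : ℝ) • (x + xr r)) ^ 2) atTop (nhds 0) →
    Tendsto (fun r => N (x - xr r)) atTop (nhds 0)

/-- `N` is a norm on the real vector space `Z`. -/
def IsNorm {Z : Type*} [AddCommGroup Z] [Module ℝ Z] (N : Z → ℝ) : Prop :=
  (∀ z, 0 ≤ N z) ∧ (∀ z, N z = 0 → z = 0) ∧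
    (∀ (c : ℝ) (z : Z), N (c • z) = |c| * N z) ∧
    ∀ z w, N (z + w) ≤ N z + N w

/-- `(X,T')` is fragmented by `d` (relative to the topology `T'`): every nonempty
subset has a relatively `T'`-open nonempty piece of `d`-diameter at most `ε`. -/
def FragmentedBy {K : Type*} (T' : TopologicalSpace K) (d : K → K → ℝ) : Prop :=
  ∀ Y : Set K, Y.Nonempty → ∀ ε : ℝ, 0 < ε →
    ∃ U : Set K, T'.IsOpen U ∧ (Y ∩ U).Nonempty ∧
      ∀ t ∈ Y ∩ U, ∀ u ∈ Y ∩ U, d t u ≤ ε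

/-- A compact Hausdorff space is Radon–Nikodym if it is fragmented by some metric
which is lower semicontinuous on `K × K`. -/
def RadonNikodymCompact (K : Type*) [T : TopologicalSpace K] [CompactSpace K]
    [T2Space K] : Prop :=
  ∃ d : K → K → ℝ, IsMetricOn K d ∧
    LowerSemicontinuous (fun p : K × K => d p.1 p.2) ∧ FragmentedBy T d

/-- A compact Hausdorff space is descriptive if property `P(d,T)` holds for some
metric `d` whose topology is finer than `T`. -/
def DescriptiveCompact (K : Type*) [T : TopologicalSpace K] [CompactSpace K]
    [T2Space K] : Prop :=
  ∃ d : K → K → ℝ, IsMetricOn K d ∧ metricTopology d ≤ T ∧ PropertyP T d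

universe u

section QForms
variable {E : Type*} [NormedAddCommGroup E] [NormedSpace ℝ E]

/-- Convex, 2-homogeneous, nonnegative functions dominated by the square of the norm. -/
structure QF (q : E → ℝ) : Prop where
  nonneg : ∀ f, 0 ≤ q f
  hom : ∀ (c : ℝ) f, q (c • f) = c ^ 2 * q f
  conv : ∀ f g (a b : ℝ), 0 ≤ a → 0 ≤ b → a + b = 1 → q (a • f + b • g) ≤ a * q f + b * q g
  bdd : ∀ f, q f ≤ ‖f‖ ^ 2

/-- The convexity defect. -/
noncomputable def QQ (q : E → ℝ) (f g : E) : ℝ := (1/2) * q f + (1/2) * q g - q ((1/2 : ℝ) • (f + g))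

lemma QF.QQ_nonneg {q : E → ℝ} (h : QF q) (f g : E) : 0 ≤ QQ q f g := by
  have := h.conv f g (1/2) (1/2) (by norm_num) (by norm_num) (by norm_num)
  unfold QQ
  rw [smul_add]; linarith

lemma QF.mid {q : E → ℝ} (h : QF q) (f g : E) :
    q ((1/2 : ℝ) • (f + g)) ≤ (1/2) * q f + (1/2) * q g := by
  have := h.QQ_nonneg f g
  unfold QQ at this; linarith

lemma QF.iSup {ι : Type*} {q : ι → E → ℝ} (h : ∀ i, QF (q i)) :
    QF (fun f => ⨆ i, q i f) := by
  have hb : ∀ f, BddAbove (Set.range fun i => q i f) := fun f =>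
    ⟨‖f‖ ^ 2, by rintro _ ⟨i, rfl⟩; exact (h i).bdd f⟩
  have h0 : ∀ f, 0 ≤ ⨆ i, q i f := fun f => Real.iSup_nonneg fun i => (h i).nonneg f
  refine ⟨h0, ?_, ?_, ?_⟩
  · intro c f
    simp only [(h _).hom]
    rw [Real.mul_iSup_of_nonneg (sq_nonneg c)]
  · intro f g a b ha hb' hab
    refine Real.iSup_le (fun i => ?_) (by have := h0 f; have := h0 g; positivity)
    refine ((h i).conv f g a b ha hb' hab).trans ?_
    have h1 := le_ciSup (hb f) i
    have h2 := le_ciSup (hb g) i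
    gcongr
  · intro f
    exact Real.iSup_le (fun i => (h i).bdd f) (sq_nonneg _)

lemma QF.add {p q : E → ℝ} {s t : ℝ} (hp : QF p) (hq : QF q) (hs : 0 ≤ s) (ht : 0 ≤ t)
    (hst : s + t ≤ 1) : QF (fun f => s * p f + t * q f) := by
  refine ⟨fun f => ?_, fun c f => ?_, fun f g a b ha hb hab => ?_, fun f => ?_⟩
  · have := hp.nonneg f; have := hq.nonneg f; positivity
  · simp only [hp.hom, hq.hom]; ring
  · have h1 := mul_le_mul_of_nonneg_left (hp.conv f g a b ha hb hab) hs
    have h2 := mul_le_mul_of_nonneg_left (hq.conv f g a b ha hb hab) ht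
    linarith
  · have h1 := mul_le_mul_of_nonneg_left (hp.bdd f) hs
    have h2 := mul_le_mul_of_nonneg_left (hq.bdd f) ht
    have h3 := mul_le_mul_of_nonneg_right hst (sq_nonneg ‖f‖)
    linarith

/-- weighted average of a finite family -/
noncomputable def avg {ι : Type*} (A : Finset ι) (q : ι → E → ℝ) (f : E) : ℝ :=
  ∑ i ∈ A, (1 / ((A.card : ℝ) + 1)) * q i f

lemma QF.avg {ι : Type*} (A : Finset ι) {q : ι → E → ℝ} (h : ∀ i, QF (q i)) :
    QF (avg A q) := by
  have hw : (0:ℝ) ≤ 1 / ((A.card : ℝ) + 1) := by positivity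
  refine ⟨fun f => ?_, fun c f => ?_, fun f g a b ha hb hab => ?_, fun f => ?_⟩
  · exact Finset.sum_nonneg fun i _ => mul_nonneg hw ((h i).nonneg f)
  · unfold _root_.avg
    rw [Finset.mul_sum]
    refine Finset.sum_congr rfl fun i _ => ?_
    rw [(h i).hom]; ring
  · unfold _root_.avg
    rw [Finset.mul_sum, Finset.mul_sum, ← Finset.sum_add_distrib]
    refine Finset.sum_le_sum fun i _ => ?_
    have h1 := mul_le_mul_of_nonneg_left ((h i).conv f g a b ha hb hab) hw
    linarith
  · unfold _root_.avg
    calc _ ≤ ∑ i ∈ A, (1 / ((A.card : ℝ) + 1)) * ‖f‖ ^ 2 :=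
          Finset.sum_le_sum fun i _ => mul_le_mul_of_nonneg_left ((h i).bdd f) hw
      _ = (A.card / ((A.card : ℝ) + 1)) * ‖f‖ ^ 2 := by
          rw [Finset.sum_const, nsmul_eq_mul]; ring
      _ ≤ 1 * ‖f‖ ^ 2 := by
          gcongr
          rw [div_le_one (by positivity)]; linarith
      _ = _ := one_mul _

lemma QQ_avg {ι : Type*} (A : Finset ι) {q : ι → E → ℝ} (h : ∀ i, QF (q i)) (f g : E)
    {i : ι} (hi : i ∈ A) : QQ (q i) f g ≤ ((A.card : ℝ) + 1) * QQ (avg A q) f g := by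
  have e : ((A.card : ℝ) + 1) * QQ (avg A q) f g = ∑ i ∈ A, QQ (q i) f g := by
    have hc : ((A.card : ℝ) + 1) ≠ 0 := by positivity
    unfold QQ avg
    simp only [← Finset.mul_sum, Finset.sum_add_distrib, Finset.sum_sub_distrib]
    field_simp
  rw [e]
  exact Finset.single_le_sum (f := fun i => QQ (q i) f g) (fun i _ => (h i).QQ_nonneg f g) hi

/-- weighted infinite sum -/
noncomputable def wsum (q : ℕ → E → ℝ) (f : E) : ℝ := ∑' n, (1/2 : ℝ) ^ (n + 1) * q n f

lemma hasSum_w : HasSum (fun n : ℕ => (1/2 : ℝ) ^ (n + 1)) 1 := by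
  have := hasSum_geometric_two' 1
  convert this using 2 with n
  simp [pow_succ]; ring

lemma summable_w {q : ℕ → E → ℝ} (h : ∀ i, QF (q i)) (f : E) :
    Summable fun n => (1/2 : ℝ) ^ (n + 1) * q n f := by
  refine Summable.of_nonneg_of_le (fun n => mul_nonneg (by positivity) ((h n).nonneg f))
    (fun n => mul_le_mul_of_nonneg_left ((h n).bdd f) (by positivity)) ?_
  exact hasSum_w.summable.mul_right _

lemma QF.wsum {q : ℕ → E → ℝ} (h : ∀ i, QF (q i)) : QF (wsum q) := by
  refine ⟨fun f => ?_, fun c f => ?_, fun f g a b ha hb hab => ?_, fun f => ?_⟩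
  · exact tsum_nonneg fun n => mul_nonneg (by positivity) ((h n).nonneg f)
  · unfold _root_.wsum
    rw [← tsum_mul_left]
    refine tsum_congr fun n => ?_
    rw [(h n).hom]; ring
  · unfold _root_.wsum
    rw [← tsum_mul_left, ← tsum_mul_left, ← ((summable_w h f).mul_left a).tsum_add
      ((summable_w h g).mul_left b)]
    refine (summable_w h _).tsum_le_tsum (fun n => ?_)
      (((summable_w h f).mul_left a).add ((summable_w h g).mul_left b))
    have h1 := mul_le_mul_of_nonneg_left ((h n).conv f g a b ha hb hab)
      (show (0:ℝ) ≤ (1/2) ^ (n+1) by positivity)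
    linarith
  · unfold _root_.wsum
    calc _ ≤ ∑' n : ℕ, (1/2 : ℝ) ^ (n + 1) * ‖f‖ ^ 2 :=
          (summable_w h f).tsum_le_tsum
            (fun n => mul_le_mul_of_nonneg_left ((h n).bdd f) (by positivity))
            (hasSum_w.summable.mul_right _)
      _ = _ := by rw [tsum_mul_right, hasSum_w.tsum_eq, one_mul]

lemma QQ_wsum {q : ℕ → E → ℝ} (h : ∀ i, QF (q i)) (f g : E) (n : ℕ) :
    QQ (q n) f g ≤ 2 ^ (n + 1) * QQ (wsum q) f g := by
  have e : HasSum (fun n => (1/2 : ℝ) ^ (n + 1) * QQ (q n) f g) (QQ (wsum q) f g) := by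
    unfold QQ
    have := (((summable_w h f).hasSum.mul_left (1/2)).add
      ((summable_w h g).hasSum.mul_left (1/2))).sub
      (summable_w h ((1/2 : ℝ) • (f + g))).hasSum
    have e2 : (fun n => (1/2 : ℝ) ^ (n + 1) * ((1/2) * q n f + (1/2) * q n g
        - q n ((1/2 : ℝ) • (f + g)))) = fun n => (1/2) * ((1/2 : ℝ) ^ (n + 1) * q n f)
        + (1/2) * ((1/2 : ℝ) ^ (n + 1) * q n g)
        - (1/2 : ℝ) ^ (n + 1) * q n ((1/2 : ℝ) • (f + g)) := by
      funext n; ring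
    rw [e2]; exact this
  have := e.summable.le_tsum n (fun m _ => mul_nonneg (by positivity) ((h m).QQ_nonneg f g))
  rw [e.tsum_eq] at this
  calc QQ (q n) f g = 2 ^ (n + 1) * ((1/2 : ℝ) ^ (n + 1) * QQ (q n) f g) := by
        rw [← mul_assoc, ← mul_pow]; norm_num
    _ ≤ _ := by gcongr

lemma QF.gap {ι : Type*} {q : ι → E → ℝ} (h : ∀ i, QF (q i)) {f g : E} {i₀ : ι} {η : ℝ}
    (hgap : ∀ i, i ≠ i₀ → q i f ≤ q i₀ f - η) (hη : 0 < η)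
    (hQ : QQ (fun f => ⨆ i, q i f) f g < η / 2) :
    QQ (q i₀) f g ≤ QQ (fun f => ⨆ i, q i f) f g := by
  have hb : ∀ f, BddAbove (Set.range fun i => q i f) := fun f =>
    ⟨‖f‖ ^ 2, by rintro _ ⟨i, rfl⟩; exact (h i).bdd f⟩
  have : Nonempty ι := ⟨i₀⟩
  have hf : (⨆ i, q i f) = q i₀ f := by
    refine le_antisymm (ciSup_le fun i => ?_) (le_ciSup (hb f) i₀)
    by_cases hi : i = i₀
    · rw [hi]
    · linarith [hgap i hi]
  have hg : q i₀ g ≤ ⨆ i, q i g := le_ciSup (hb g) i₀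
  have hm : (⨆ i, q i ((1/2 : ℝ) • (f + g))) ≤
      max (q i₀ ((1/2 : ℝ) • (f + g))) ((1/2) * (q i₀ f - η) + (1/2) * ⨆ i, q i g) := by
    refine ciSup_le fun i => ?_
    by_cases hi : i = i₀
    · rw [hi]; exact le_max_left _ _
    · refine le_max_of_le_right (((h i).mid f g).trans ?_)
      have := hgap i hi
      have h2 : q i g ≤ ⨆ i, q i g := le_ciSup (hb g) i
      linarith
  unfold QQ at hQ ⊢
  simp only [hf] at hQ ⊢
  rcases le_max_iff.1 hm with h1 | h1 <;> linarith

lemma deville {ι : Type*} {φ ψ : ι → E → ℝ} (hφ : ∀ i, QF (φ i)) (hψ : ∀ i, QF (ψ i)) :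
    ∃ θ : E → ℝ, QF θ ∧ ∀ (f : E) (i₀ : ι) (η : ℝ), 0 < η →
      (∀ i, i ≠ i₀ → φ i f ≤ φ i₀ f - η) → ∀ δ > 0, ∃ δ' > 0, ∀ g,
        QQ θ f g < δ' → QQ (ψ i₀) f g < δ := by
  have hpw : ∀ p : ℕ, (0:ℝ) < (1/2) ^ p := fun p => by positivity
  have hpw1 : ∀ p : ℕ, ((1:ℝ)/2) ^ p ≤ 1 := fun p => pow_le_one₀ (by norm_num) (by norm_num)
  have hc : ∀ p : ℕ, ∀ i, QF (fun f => (1/2) * φ i f + ((1/2) * (1/2) ^ p) * ψ i f) := fun p i =>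
    (hφ i).add (hψ i) (by norm_num) (by have := hpw p; positivity) (by linarith [hpw1 p])
  have hs := fun p => QF.iSup (hc p)
  refine ⟨_, QF.wsum hs, ?_⟩
  intro f i₀ η hη hgap δ hδ
  obtain ⟨p, hp⟩ : ∃ p : ℕ, (1/2 : ℝ) ^ p * ‖f‖ ^ 2 < η / 2 := by
    have : Tendsto (fun p : ℕ => (1/2 : ℝ) ^ p * ‖f‖ ^ 2) atTop (𝓝 (0 * ‖f‖ ^ 2)) :=
      (tendsto_pow_atTop_nhds_zero_of_lt_one (by norm_num) (by norm_num)).mul_const _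
    rw [zero_mul] at this
    exact (this.eventually (gt_mem_nhds (by positivity))).exists
  have hw : (0:ℝ) < 2 ^ (p + 1) := by positivity
  refine ⟨min (η / 8) ((1/2) * (1/2) ^ p * δ) / 2 ^ (p + 1), ?_, ?_⟩
  · have := hpw p
    positivity
  intro g hg
  rw [lt_div_iff₀ hw, mul_comm] at hg
  have h1 := (QQ_wsum hs f g p).trans_lt hg
  have h2 := QF.gap (hc p) (f := f) (g := g) (i₀ := i₀) (η := η / 4) ?_ (by positivity) ?_
  · have h3 := (h2.trans_lt h1).trans_le (min_le_right _ _)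
    have e : QQ (fun f => (1/2) * φ i₀ f + ((1/2) * (1/2) ^ p) * ψ i₀ f) f g =
        (1/2) * QQ (φ i₀) f g + ((1/2) * (1/2) ^ p) * QQ (ψ i₀) f g := by
      unfold QQ; ring
    rw [e] at h3
    have h4 := (hφ i₀).QQ_nonneg f g
    exact lt_of_mul_lt_mul_left (show (1/2) * (1/2) ^ p * QQ (ψ i₀) f g < (1/2) * (1/2) ^ p * δ by
      linarith) (by have := hpw p; positivity)
  · intro i hi
    have h3 := hgap i hi
    have h4 := mul_le_mul_of_nonneg_left ((hψ i).bdd f) (hpw p).le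
    have h5 := mul_nonneg (hpw p).le ((hψ i₀).nonneg f)
    nlinarith
  · have := h1.trans_le (min_le_left _ _)
    linarith

lemma QF.sqrt_add {q : E → ℝ} (h : QF q) (f g : E) :
    √(q (f + g)) ≤ √(q f) + √(q g) := by
  have key : ∀ a b : ℝ, 0 < a → 0 < b → q f ≤ a ^ 2 → q g ≤ b ^ 2 → q (f + g) ≤ (a + b) ^ 2 := by
    intro a b ha hb hfa hgb
    have h1 := h.conv (a⁻¹ • f) (b⁻¹ • g) (a / (a+b)) (b/(a+b)) (by positivity) (by positivity)
      (by field_simp)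
    rw [h.hom, h.hom, smul_smul, smul_smul] at h1
    have e1 : a / (a + b) * a⁻¹ = (a+b)⁻¹ := by field_simp
    have e2 : b / (a + b) * b⁻¹ = (a+b)⁻¹ := by field_simp
    rw [e1, e2, ← smul_add, h.hom] at h1
    have h2 : a⁻¹ ^ 2 * q f ≤ 1 := by
      rw [inv_pow, inv_mul_le_iff₀ (by positivity)]; linarith
    have h3 : b⁻¹ ^ 2 * q g ≤ 1 := by
      rw [inv_pow, inv_mul_le_iff₀ (by positivity)]; linarith
    have h4 : (a + b)⁻¹ ^ 2 * q (f + g) ≤ 1 := by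
      calc _ ≤ _ := h1
        _ ≤ a / (a + b) * 1 + b / (a+b) * 1 := by gcongr
        _ = 1 := by field_simp
    rw [inv_pow, inv_mul_le_iff₀ (by positivity)] at h4
    linarith
  refine le_of_forall_pos_le_add fun ε hε => ?_
  have := key (√(q f) + ε / 2) (√(q g) + ε / 2) (by positivity) (by positivity) ?_ ?_
  · refine (Real.sqrt_le_sqrt this).trans ?_
    rw [Real.sqrt_sq (by positivity)]; linarith
  · nlinarith [Real.sq_sqrt (h.nonneg f), Real.sqrt_nonneg (q f)]
  · nlinarith [Real.sq_sqrt (h.nonneg g), Real.sqrt_nonneg (q g)]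

lemma QF.sqrt_smul {q : E → ℝ} (h : QF q) (c : ℝ) (f : E) :
    √(q (c • f)) = |c| * √(q f) := by
  rw [h.hom, Real.sqrt_mul (sq_nonneg c), Real.sqrt_sq_eq_abs]

lemma QF.sqrt_sub {q : E → ℝ} (h : QF q) (f g : E) :
    (√(q f) - √(q g)) ^ 2 ≤ 4 * QQ q f g := by
  have h1 := h.sqrt_add f g
  have h2 := h.sqrt_smul (1/2) (f + g)
  rw [abs_of_pos (by norm_num : (0:ℝ) < 1/2)] at h2
  have h3 := Real.sq_sqrt (h.nonneg ((1/2 : ℝ) • (f + g)))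
  have h4 := Real.sq_sqrt (h.nonneg f)
  have h5 := Real.sq_sqrt (h.nonneg g)
  have h6 := Real.sqrt_nonneg (q ((1/2 : ℝ) • (f + g)))
  have h7 := Real.sqrt_nonneg (q (f + g))
  unfold QQ
  have h8 : √(q (f + g)) ^ 2 ≤ (√(q f) + √(q g)) ^ 2 := by gcongr
  rw [h2] at h3
  nlinarith

lemma QF.norm_sq : QF (fun f : E => ‖f‖ ^ 2) := by
  refine ⟨fun f => sq_nonneg _, fun c f => ?_, fun f g a b ha hb hab => ?_, fun f => le_rfl⟩
  · simp only [norm_smul, mul_pow, Real.norm_eq_abs, sq_abs]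
  · have h1 : ‖a • f + b • g‖ ≤ a * ‖f‖ + b * ‖g‖ := by
      refine (norm_add_le _ _).trans ?_
      rw [norm_smul, norm_smul, Real.norm_of_nonneg ha, Real.norm_of_nonneg hb]
    have h2 : ‖a • f + b • g‖ ^ 2 ≤ (a * ‖f‖ + b * ‖g‖) ^ 2 := by gcongr
    have hb' : b = 1 - a := by linarith
    subst hb'
    nlinarith [mul_nonneg (mul_nonneg ha hb) (sq_nonneg (‖f‖ - ‖g‖))]

end QForms

lemma metricTopology_ball {K : Type*} {d : K → K → ℝ} (hd : IsMetricOn K d) {S : Set K}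
    (hS : (metricTopology d).IsOpen S) : ∀ x ∈ S, ∃ ρ > 0, ∀ y, d x y < ρ → y ∈ S := by
  induction hS with
  | basic s hs =>
    obtain ⟨z, ε, hε, rfl⟩ := hs
    intro x hx
    refine ⟨ε - d z x, by simpa using hx, fun y hy => ?_⟩
    have := hd.triangle z x y
    simp only [Set.mem_ofPred_eq]; linarith
  | univ => exact fun x _ => ⟨1, one_pos, fun _ _ => trivial⟩
  | inter s t _ _ h1 h2 =>
    intro x hx
    obtain ⟨a, ha, h3⟩ := h1 x hx.1
    obtain ⟨b, hb, h4⟩ := h2 x hx.2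
    exact ⟨min a b, lt_min ha hb, fun y hy => ⟨h3 y (hy.trans_le (min_le_left _ _)),
      h4 y (hy.trans_le (min_le_right _ _))⟩⟩
  | sUnion c _ h =>
    rintro x ⟨s, hs, hx⟩
    obtain ⟨a, ha, h3⟩ := h s hs x hx
    exact ⟨a, ha, fun y hy => ⟨s, hs, h3 y hy⟩⟩

lemma generate_local {K : Type*} {T : TopologicalSpace K} {B : ℕ → Set K} {S : Set K}
    (hS : (TopologicalSpace.generateFrom ({U | T.IsOpen U} ∪ Set.range B)).IsOpen S) :
    ∀ x ∈ S, ∃ (U : Set K) (F : Finset ℕ), IsOpen U ∧ x ∈ U ∧ (∀ n ∈ F, x ∈ B n) ∧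
      ∀ y ∈ U, (∀ n ∈ F, y ∈ B n) → y ∈ S := by
  classical
  induction hS with
  | basic s hs =>
    intro x hx
    rcases hs with hs | ⟨n, rfl⟩
    · exact ⟨s, ∅, hs, hx, by simp, fun y hy _ => hy⟩
    · exact ⟨Set.univ, {n}, isOpen_univ, trivial, by simpa using hx, fun y _ hy => by simpa using hy⟩
  | univ => exact fun x _ => ⟨Set.univ, ∅, isOpen_univ, trivial, by simp, fun _ _ _ => trivial⟩
  | inter s t _ _ h1 h2 =>
    intro x hx
    obtain ⟨U, F, hU, hxU, hF, h3⟩ := h1 x hx.1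
    obtain ⟨V, G, hV, hxV, hG, h4⟩ := h2 x hx.2
    refine ⟨U ∩ V, F ∪ G, hU.inter hV, ⟨hxU, hxV⟩, ?_, ?_⟩
    · intro n hn
      rcases Finset.mem_union.1 hn with h | h
      · exact hF n h
      · exact hG n h
    · intro y hy hn
      exact ⟨h3 y hy.1 fun n h => hn n (Finset.mem_union_left _ h),
        h4 y hy.2 fun n h => hn n (Finset.mem_union_right _ h)⟩
  | sUnion c _ h =>
    rintro x ⟨s, hs, hx⟩
    obtain ⟨U, F, hU, hxU, hF, h3⟩ := h s hs x hx
    exact ⟨U, F, hU, hxU, hF, fun y hy hn => ⟨s, hs, h3 y hy hn⟩⟩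

/-- Descriptive compacta: every open family has a sigma-isolated refinement. -/
lemma descriptive_refine {K : Type*} [TopologicalSpace K] [CompactSpace K] [T2Space K]
    (hdesc : DescriptiveCompact K) {ι : Type*} (V : ι → Set K) (hV : ∀ i, IsOpen (V i)) :
    ∃ N O : ℕ → ι → Set K, (∀ n i, IsOpen (O n i)) ∧ (∀ n i, O n i ⊆ V i) ∧
      (∀ n i, N n i ⊆ O n i) ∧ (∀ n i j, ∀ y, y ∈ O n i → y ∈ N n j → i = j) ∧
      ∀ i, ∀ y ∈ V i, ∃ n j, y ∈ N n j := by
  obtain ⟨d, hd, hdT, B, hB⟩ := hdesc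
  obtain ⟨_, hwf⟩ := exists_wellFoundedLT ι
  have hnn : ∀ x y, 0 ≤ d x y := fun x y => by
    have h1 := hd.triangle x y x
    rw [hd.self_eq_zero, hd.symm y x] at h1; linarith
  let W : ℕ → ι → Set K := fun m i => {z | ∃ x, x ∈ V i ∧ (∀ j < i, x ∉ V j) ∧
    (∀ y, d x y < 1 / ((m:ℝ) + 1) → y ∈ V i) ∧ d x z < 1 / ((m:ℝ) + 1) / 2}
  have hWopen : ∀ m i, (metricTopology d).IsOpen (W m i) := by
    intro m i
    have : W m i = ⋃₀ {S | ∃ x, (x ∈ V i ∧ (∀ j < i, x ∉ V j) ∧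
      (∀ y, d x y < 1 / ((m:ℝ) + 1) → y ∈ V i)) ∧ S = {z | d x z < 1 / ((m:ℝ) + 1) / 2}} := by
      ext z
      constructor
      · rintro ⟨x, h1, h2, h3, h4⟩
        exact ⟨_, ⟨x, ⟨h1, h2, h3⟩, rfl⟩, h4⟩
      · rintro ⟨_, ⟨x, ⟨h1, h2, h3⟩, rfl⟩, h4⟩
        exact ⟨x, h1, h2, h3, h4⟩
    rw [this]
    refine (metricTopology d).isOpen_sUnion _ ?_
    rintro _ ⟨x, _, rfl⟩
    exact TopologicalSpace.GenerateOpen.basic _ ⟨x, _, by positivity, rfl⟩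
  have hWaux : ∀ m i j z, z ∈ W m i → z ∈ W m j → ¬ i < j := by
    rintro m i j z ⟨x, h1, h2, h3, h4⟩ ⟨x', h1', h2', h3', h4'⟩ hij
    refine h2' i hij (h3 x' ?_)
    have := hd.triangle x z x'
    rw [hd.symm z x'] at this
    linarith
  have hWdisj : ∀ m i j z, z ∈ W m i → z ∈ W m j → i = j := fun m i j z h1 h2 =>
    le_antisymm (not_lt.1 (hWaux m j i z h2 h1)) (not_lt.1 (hWaux m i j z h1 h2))
  let BF : Finset ℕ → Set K := fun F => {y | ∀ n ∈ F, y ∈ B n}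
  let O' : ℕ × Finset ℕ → ι → Set K := fun s i =>
    V i ∩ ⋃₀ {U | IsOpen U ∧ U ∩ BF s.2 ⊆ W s.1 i}
  obtain ⟨e, he⟩ := exists_surjective_nat (ℕ × Finset ℕ)
  refine ⟨fun n i => O' (e n) i ∩ BF (e n).2, fun n i => O' (e n) i, ?_, ?_, ?_, ?_, ?_⟩
  · exact fun n i => (hV i).inter (isOpen_sUnion fun U hU => hU.1)
  · exact fun n i => Set.inter_subset_left
  · exact fun n i => Set.inter_subset_left
  · rintro n i j y ⟨_, U, ⟨_, hU⟩, hyU⟩ ⟨⟨_, U', ⟨_, hU'⟩, hyU'⟩, hy⟩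
    exact hWdisj _ _ _ y (hU ⟨hyU, hy⟩) (hU' ⟨hyU', hy⟩)
  · intro i₀ y hy
    have hne : {i | y ∈ V i}.Nonempty := ⟨i₀, hy⟩
    set i := wellFounded_lt.min {i | y ∈ V i} hne with hi
    have hyi : y ∈ V i := wellFounded_lt.min_mem {i | y ∈ V i} hne
    have hmin : ∀ j < i, y ∉ V j := fun j hj hjy => wellFounded_lt.not_lt_min {i | y ∈ V i} hjy hj
    obtain ⟨ρ, hρ, hball⟩ := metricTopology_ball hd (hdT _ (hV i)) y hyi
    obtain ⟨m, hm⟩ := exists_nat_one_div_lt hρ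
    have hyW : y ∈ W m i := ⟨y, hyi, hmin, fun z hz => hball z (hz.trans hm), by
      rw [hd.self_eq_zero]; positivity⟩
    obtain ⟨U, F, hU, hyU, hyF, h3⟩ := generate_local (hB _ (hWopen m i)) y hyW
    obtain ⟨n, hn⟩ := he (m, F)
    refine ⟨n, i, ?_⟩
    simp only [hn]
    exact ⟨⟨hyi, U, ⟨hU, fun z hz => h3 z hz.1 hz.2⟩, hyU⟩, hyF⟩

/-- interface extracted from being a continuous image of a Radon-Nikodym compact -/
lemma image_interface {K : Type u} [TopologicalSpace K] [CompactSpace K] [T2Space K]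
    (himage : ∃ (K' : Type u) (_ : TopologicalSpace K') (_ : CompactSpace K')
      (_ : T2Space K'), RadonNikodymCompact K' ∧
        ∃ π : K' → K, Continuous π ∧ Function.Surjective π) :
    ∃ rel : ℕ → K → K → Prop,
      (∀ k (Z : Set K), IsClosed Z → Z.Nonempty → ∃ U, IsOpen U ∧ (Z ∩ U).Nonempty ∧
        ∀ t ∈ Z ∩ U, ∀ u ∈ Z ∩ U, rel k t u) ∧
      ∀ (f : C(K, ℝ)) (ε : ℝ), 0 < ε → ∃ k, ∀ t u, rel k t u → |f t - f u| ≤ ε := by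
  obtain ⟨K', _, _, _, ⟨d, hd, hlsc, hfrag⟩, π, hπ, hsurj⟩ := himage
  have hnn : ∀ x y, 0 ≤ d x y := fun x y => by
    have h1 := hd.triangle x y x
    rw [hd.self_eq_zero, hd.symm y x] at h1; linarith
  refine ⟨fun k t u => ∃ t' u', π t' = t ∧ π u' = u ∧ d t' u' ≤ 1 / ((k:ℝ) + 1), ?_, ?_⟩
  · intro k Z hZ hne
    have hZc : CompactSpace {x // π x ∈ Z} :=
      isCompact_iff_compactSpace.1 (hZ.preimage hπ).isCompact
    let ρ : {x // π x ∈ Z} → Z := fun x => ⟨π x.1, x.2⟩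
    have hρ : Continuous ρ := by fun_prop
    have hρs : Function.Surjective ρ := by
      rintro ⟨z, hz⟩
      obtain ⟨x, rfl⟩ := hsurj z
      exact ⟨⟨x, hz⟩, rfl⟩
    obtain ⟨Y, hYc, hYs, hYmin⟩ := exists_compact_surjective_zorn_subset hρ hρs
    have hYne : Y.Nonempty := by
      obtain ⟨z, hz⟩ := hne
      obtain ⟨y, hy, _⟩ : (⟨z, hz⟩ : Z) ∈ ρ '' Y := by rw [hYs]; trivial
      exact ⟨y, hy⟩
    obtain ⟨U, hU, ⟨y, hy, hyU⟩, hdiam⟩ := hfrag (Subtype.val '' Y) (hYne.image _)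
      (1 / ((k:ℝ) + 1)) (by positivity)
    have hU' : IsOpen U := hU
    let E₀ : Set Y := {y | (y.1.1 : K') ∉ U}
    have hE₀ : IsClosed E₀ := by
      have : IsOpen {y : Y | (y.1.1 : K') ∈ U} := hU'.preimage (by fun_prop)
      exact this.isClosed_compl
    have hne₀ : E₀ ≠ Set.univ := by
      obtain ⟨y', hy', rfl⟩ := hy
      intro h
      have : (⟨y', hy'⟩ : Y) ∈ E₀ := by rw [h]; trivial
      exact this hyU
    have him := hYmin E₀ hne₀ hE₀
    have hcont : Continuous fun y : Y => π y.1.1 := by fun_prop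
    have hcl : IsClosed ((fun y : Y => π y.1.1) '' E₀) :=
      (hE₀.isCompact.image hcont).isClosed
    have hlift : ∀ t ∈ Z ∩ ((fun y : Y => π y.1.1) '' E₀)ᶜ, ∃ t', t' ∈ Subtype.val '' Y ∩ U ∧
        π t' = t := by
      rintro t ⟨htZ, ht⟩
      obtain ⟨y', hy', hyt⟩ : (⟨t, htZ⟩ : Z) ∈ ρ '' Y := by rw [hYs]; trivial
      have hyt' : π y'.1 = t := congrArg Subtype.val hyt
      refine ⟨y'.1, ⟨⟨y', hy', rfl⟩, ?_⟩, hyt'⟩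
      by_contra hnot
      exact ht ⟨⟨y', hy'⟩, hnot, hyt'⟩
    refine ⟨_, hcl.isOpen_compl, ?_, ?_⟩
    · by_contra hempty
      apply him
      rw [Set.eq_univ_iff_forall]
      rintro ⟨z, hz⟩
      by_contra hnot
      refine hempty ⟨z, hz, ?_⟩
      rintro ⟨y', hy', h⟩
      exact hnot ⟨y', hy', Subtype.ext h⟩
    · intro t ht u hu
      obtain ⟨t', h1, h2⟩ := hlift t ht
      obtain ⟨u', h3, h4⟩ := hlift u hu
      exact ⟨t', u', h2, h4, hdiam t' h1 u' h3⟩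
  · intro f ε hε
    by_contra! hcon
    let S : ℕ → Set (K' × K') := fun k =>
      {p | d p.1 p.2 ≤ 1 / ((k:ℝ) + 1)} ∩ {p | ε ≤ |f (π p.1) - f (π p.2)|}
    have hScl : ∀ k, IsClosed (S k) := fun k =>
      (hlsc.isClosed_preimage _).inter (isClosed_le (by fun_prop) (by fun_prop))
    obtain ⟨p, hp⟩ := IsCompact.nonempty_iInter_of_sequence_nonempty_isCompact_isClosed S
      (fun k p hp => ⟨(show d p.1 p.2 ≤ _ from hp.1).trans (by
        push_cast
        apply one_div_le_one_div_of_le <;> [positivity; linarith]), hp.2⟩)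
      (fun k => by
        obtain ⟨_, _, ⟨t', u', rfl, rfl, h⟩, h2⟩ := hcon k
        exact ⟨(t', u'), h, h2.le⟩) (hScl 0).isCompact hScl
    rw [Set.mem_iInter] at hp
    have h0 : d p.1 p.2 ≤ 0 := by
      refine le_of_forall_pos_le_add fun δ hδ => ?_
      obtain ⟨k, hk⟩ := exists_nat_one_div_lt hδ
      have := (hp k).1
      simp only [Set.mem_ofPred_eq] at this
      linarith
    have := hd.eq_of_dist_eq_zero _ _ (le_antisymm h0 (hnn _ _))
    have h2 := (hp 0).2
    simp only [Set.mem_ofPred_eq, this, sub_self, abs_zero] at h2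
    linarith

section Main
variable {K : Type*} [TopologicalSpace K] [CompactSpace K]

/-- `Good Mod F`: some form controls uniform closeness on `F`. -/
def Good (Mod : ℝ → C(K, ℝ) → Prop) (F : Set K) : Prop :=
  ∃ q : C(K, ℝ) → ℝ, QF q ∧ ∀ ε > 0, ∀ f, Mod ε f → ∃ δ > 0, ∀ g, QQ q f g < δ →
    ∀ y ∈ F, |f y - g y| ≤ 5 * ε

lemma Good.mono {Mod : ℝ → C(K, ℝ) → Prop} {F G : Set K} (h : Good Mod G) (hFG : F ⊆ G) :
    Good Mod F := by
  obtain ⟨q, hq, h⟩ := h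
  refine ⟨q, hq, fun ε hε f hf => ?_⟩
  obtain ⟨δ, hδ, h⟩ := h ε hε f hf
  exact ⟨δ, hδ, fun g hg y hy => h g hg y (hFG hy)⟩

lemma QQ_add {E : Type*} [NormedAddCommGroup E] [NormedSpace ℝ E] (p q : E → ℝ) (s t : ℝ)
    (f g : E) : QQ (fun f => s * p f + t * q f) f g = s * QQ p f g + t * QQ q f g := by
  unfold QQ; ring

lemma Good.union {Mod : ℝ → C(K, ℝ) → Prop} {F G : Set K} (hF : Good Mod F) (hG : Good Mod G) :
    Good Mod (F ∪ G) := by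
  obtain ⟨p, hp, h1⟩ := hF
  obtain ⟨q, hq, h2⟩ := hG
  refine ⟨_, hp.add (s := 1/2) (t := 1/2) hq (by norm_num) (by norm_num) (by norm_num), ?_⟩
  intro ε hε f hf
  obtain ⟨δ₁, hδ₁, h1⟩ := h1 ε hε f hf
  obtain ⟨δ₂, hδ₂, h2⟩ := h2 ε hε f hf
  refine ⟨min δ₁ δ₂ / 2, by positivity, fun g hg => ?_⟩
  rw [QQ_add] at hg
  have a := hp.QQ_nonneg f g
  have b := hq.QQ_nonneg f g
  have c := min_le_left δ₁ δ₂
  have d := min_le_right δ₁ δ₂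
  rintro y (hy | hy)
  · exact h1 g (by linarith) y hy
  · exact h2 g (by linarith) y hy

lemma Good.empty (Mod : ℝ → C(K, ℝ) → Prop) : Good Mod (∅ : Set K) :=
  ⟨_, QF.norm_sq, fun ε _ f _ => ⟨1, one_pos, fun g _ y hy => absurd hy (Set.notMem_empty y)⟩⟩

lemma QF.diff (x y : K) : QF (fun f : C(K, ℝ) => (f y - f x) ^ 2 / 4) := by
  refine ⟨fun f => by positivity, fun c f => ?_, fun f g a b ha hb hab => ?_, fun f => ?_⟩
  · simp; ring
  · simp only [ContinuousMap.add_apply, ContinuousMap.smul_apply, smul_eq_mul]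
    have hb' : b = 1 - a := by linarith
    subst hb'
    nlinarith [mul_nonneg (mul_nonneg ha hb) (sq_nonneg ((f y - f x) - (g y - g x)))]
  · have h1 := abs_le.1 (f.norm_coe_le_norm x)
    have h2 := abs_le.1 (f.norm_coe_le_norm y)
    have : (f y - f x) ^ 2 ≤ (2 * ‖f‖) ^ 2 := by
      apply sq_le_sq'
      · linarith [h1.2, h2.1]
      · linarith [h1.1, h2.2]
    linarith

lemma QF.eval (x : K) : QF (fun f : C(K, ℝ) => (f x) ^ 2) := by
  refine ⟨fun f => by positivity, fun c f => ?_, fun f g a b ha hb hab => ?_, fun f => ?_⟩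
  · simp; ring
  · simp only [ContinuousMap.add_apply, ContinuousMap.smul_apply, smul_eq_mul]
    have hb' : b = 1 - a := by linarith
    subst hb'
    nlinarith [mul_nonneg (mul_nonneg ha hb) (sq_nonneg (f x - g x))]
  · exact sq_le_sq' (abs_le.1 (f.norm_coe_le_norm x)).1 (abs_le.1 (f.norm_coe_le_norm x)).2

/-- squared oscillation from the value at `x` -/
noncomputable def osc (x : K) (S : Set K) (f : C(K, ℝ)) : ℝ := ⨆ y : S, (f y - f x) ^ 2 / 4

lemma QF.osc (x : K) (S : Set K) : QF (osc x S) := QF.iSup fun y : S => QF.diff x y.1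

lemma le_osc (x : K) {S : Set K} (f : C(K, ℝ)) {y : K} (hy : y ∈ S) :
    (f y - f x) ^ 2 / 4 ≤ osc x S f :=
  le_ciSup (f := fun y : S => (f y - f x) ^ 2 / 4)
    ⟨‖f‖ ^ 2, by rintro _ ⟨i, rfl⟩; exact (QF.diff x i.1).bdd f⟩ ⟨y, hy⟩

lemma le_osc_closure (x : K) {S : Set K} (f : C(K, ℝ)) {y : K} (hy : y ∈ closure S) :
    (f y - f x) ^ 2 / 4 ≤ osc x S f := by
  have hc : IsClosed {y | (f y - f x) ^ 2 / 4 ≤ osc x S f} :=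
    isClosed_le (by fun_prop) continuous_const
  exact closure_minimal (fun y hy => le_osc x f hy) hc hy

lemma osc_le (x : K) {S : Set K} (f : C(K, ℝ)) {t : ℝ} (ht : 0 ≤ t)
    (h : ∀ y ∈ S, (f y - f x) ^ 2 / 4 ≤ t) : osc x S f ≤ t :=
  Real.iSup_le (fun y => h y.1 y.2) ht

variable {ι : Type*}

/-- closed sets attached to a path -/
def cset (L : Set K) (N O : ℕ → ι → Set K) : List ℕ → Set K → Set K
  | [], R => L \ R
  | n :: p, R => closure (cset L N O p R ∩ ⋃ i, N n i) \ ⋃ i, O n i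

/-- the finite set `A` is strictly selected by `f` -/
def Sel (L : Set K) (x : K) (N O : ℕ → ι → Set K) (f : C(K, ℝ)) (p : List ℕ) (n : ℕ)
    (A : Finset ι) (R : Set K) : Prop :=
  ∃ t u : ℝ, t < u ∧ (∀ i ∈ A, u ≤ osc x (cset L N O p R ∩ N n i) f) ∧
    ∀ i ∉ A, osc x (cset L N O p R ∩ N n i) f ≤ t

/-- `f` follows the program -/
def Reach (L : Set K) (x : K) (N O : ℕ → ι → Set K) (f : C(K, ℝ)) (ε : ℝ) :
    List (List ℕ × ℕ × ℕ) → Set K → Prop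
  | [], R => ∀ y ∈ L \ R, |f y - f x| ≤ 2 * ε
  | (p, n, k) :: s, R => ∃ A : Finset ι, A.card = k ∧ Sel L x N O f p n A R ∧
      Reach L x N O f ε s (R ∪ ⋃ i ∈ A, O n i)

lemma avg_gap {E : Type*} [NormedAddCommGroup E] [NormedSpace ℝ E] {q : ι → E → ℝ} {f : E}
    {A B : Finset ι} (hAB : B.card = A.card) (hne : B ≠ A) {t u : ℝ} (htu : t < u)
    (hA : ∀ i ∈ A, u ≤ q i f) (hB : ∀ i ∉ A, q i f ≤ t) :
    avg B q f ≤ avg A q f - (u - t) / ((A.card : ℝ) + 1) := by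
  classical
  unfold avg
  rw [← Finset.mul_sum, ← Finset.mul_sum, hAB]
  have h1 := Finset.sum_inter_add_sum_sdiff A B (fun i => q i f)
  have h2 := Finset.sum_inter_add_sum_sdiff B A (fun i => q i f)
  rw [Finset.inter_comm] at h2
  have hc : (B \ A).card = (A \ B).card := by
    have h3 := Finset.card_sdiff_add_card_inter A B
    have h4 := Finset.card_sdiff_add_card_inter B A
    rw [Finset.inter_comm] at h4
    omega
  have hpos : 1 ≤ (A \ B).card := by
    rw [Nat.one_le_iff_ne_zero, ← hc]
    intro h0
    rw [Finset.card_eq_zero, Finset.sdiff_eq_empty_iff_subset] at h0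
    exact hne (Finset.eq_of_subset_of_card_le h0 hAB.ge)
  have h5 : ∑ i ∈ B \ A, q i f ≤ (A \ B).card * t := by
    have := Finset.sum_le_card_nsmul (B \ A) (fun i => q i f) t
      (fun i hi => hB i (Finset.mem_sdiff.1 hi).2)
    rwa [hc, nsmul_eq_mul] at this
  have h6 : (A \ B).card * u ≤ ∑ i ∈ A \ B, q i f := by
    have := Finset.card_nsmul_le_sum (A \ B) (fun i => q i f) u
      (fun i hi => hA i (Finset.mem_sdiff.1 hi).1)
    rwa [nsmul_eq_mul] at this
  have h7 : (1:ℝ) ≤ (A \ B).card := by exact_mod_cast hpos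
  have h8 : ∑ i ∈ B, q i f ≤ ∑ i ∈ A, q i f - (u - t) := by nlinarith
  have hw : (0:ℝ) < 1 / ((A.card : ℝ) + 1) := by positivity
  have := mul_le_mul_of_nonneg_left h8 hw.le
  calc _ ≤ _ := this
    _ = _ := by ring

lemma programForm (Mod : ℝ → C(K, ℝ) → Prop) (L : Set K) (x : K) (N O : ℕ → ι → Set K)
    (hO : ∀ n i, Good Mod (O n i)) (s : List (List ℕ × ℕ × ℕ)) : ∀ R : Set K,
    ∃ q : C(K, ℝ) → ℝ, QF q ∧ ∀ ε > 0, ∀ f, Mod ε f → Reach L x N O f ε s R →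
      ∃ δ > 0, ∀ g, QQ q f g < δ → |f x - g x| ≤ ε / 2 → ∀ y ∈ L \ R, |f y - g y| ≤ 5 * ε := by
  induction s with
  | nil =>
    intro R
    refine ⟨osc x (L \ R), QF.osc _ _, fun ε hε f _ hreach => ?_⟩
    refine ⟨ε ^ 2 / 64, by positivity, fun g hg hx y hy => ?_⟩
    have h1 := (QF.osc x (L \ R)).sqrt_sub f g
    have h2 : osc x (L \ R) f ≤ ε ^ 2 := osc_le x f (by positivity) fun z hz => by
      have := hreach z hz
      have : (f z - f x) ^ 2 ≤ (2 * ε) ^ 2 := sq_le_sq' (abs_le.1 this).1 (abs_le.1 this).2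
      linarith
    have h3 : √(osc x (L \ R) f) ≤ ε := by
      rw [← Real.sqrt_sq hε.le]; exact Real.sqrt_le_sqrt h2
    have h4 : |√(osc x (L \ R) f) - √(osc x (L \ R) g)| ≤ ε / 4 := by
      apply abs_le_of_sq_le_sq _ (by positivity)
      nlinarith
    have h5 : √(osc x (L \ R) g) ≤ ε + ε / 4 := by linarith [(abs_le.1 h4).1]
    have h6 := le_osc x g hy
    have h7 : |g y - g x| / 2 ≤ ε + ε / 4 := by
      refine le_trans ?_ h5
      apply Real.le_sqrt_of_sq_le
      rw [div_pow, sq_abs]; linarith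
    have h8' : |g y - g x| ≤ 2 * ε + ε / 2 := by linarith
    have h9 := abs_le.1 h8'
    have h10 := abs_le.1 (hreach y hy)
    have h11 := abs_le.1 hx
    rw [abs_le]
    constructor <;> linarith [h9.1, h9.2, h10.1, h10.2, h11.1, h11.2]
  | cons c s ih =>
    obtain ⟨p, n, k⟩ := c
    intro R
    choose qs hqs hqs' using fun A : {A : Finset ι // A.card = k} => ih (R ∪ ⋃ i ∈ A.1, O n i)
    choose qo hqo hqo' using hO n
    obtain ⟨θ, hθ, hdev⟩ := deville
      (φ := fun A : {A : Finset ι // A.card = k} =>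
        avg A.1 (fun i => osc x (cset L N O p R ∩ N n i)))
      (ψ := fun A : {A : Finset ι // A.card = k} =>
        fun f => (1/2) * qs A f + (1/2) * avg A.1 qo f)
      (fun A => QF.avg A.1 fun i => QF.osc _ _)
      (fun A => (hqs A).add (QF.avg A.1 hqo) (by norm_num) (by norm_num) (by norm_num))
    refine ⟨θ, hθ, fun ε hε f hf hreach => ?_⟩
    obtain ⟨A, hAk, ⟨t, u, htu, hA, hB⟩, hreach⟩ := hreach
    have hk : (0:ℝ) < (A.card : ℝ) + 1 := by positivity
    have hdev' := hdev f ⟨A, hAk⟩ ((u - t) / ((A.card : ℝ) + 1))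
      (div_pos (by linarith) hk) (by
        rintro ⟨B, hBk⟩ hne
        exact avg_gap (hBk.trans hAk.symm) (fun h => hne (Subtype.ext h)) htu hA hB)
    obtain ⟨δ₁, hδ₁, h1⟩ := hqs' ⟨A, hAk⟩ ε hε f hf hreach
    choose δo hδo ho using fun i => hqo' i ε hε f hf
    obtain ⟨δ₂, hδ₂, h2⟩ : ∃ δ₂ > 0, ∀ i ∈ A, δ₂ ≤ δo i := by
      clear hdev' hreach hA hB hAk hk h1
      classical
      induction A using Finset.induction_on with
      | empty => exact ⟨1, one_pos, by simp⟩
      | insert a A _ ih =>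
        obtain ⟨δ, hδ, h⟩ := ih
        refine ⟨min δ (δo a), lt_min hδ (hδo a), fun i hi => ?_⟩
        rcases Finset.mem_insert.1 hi with rfl | hi
        · exact min_le_right _ _
        · exact (min_le_left _ _).trans (h i hi)
    obtain ⟨δ', hδ', h3⟩ := hdev' (min (δ₁ / 2) (δ₂ / (2 * ((A.card : ℝ) + 1)))) (by positivity)
    refine ⟨δ', hδ', fun g hg hx y hy => ?_⟩
    have h4 := h3 g hg
    rw [QQ_add] at h4
    have a := (hqs ⟨A, hAk⟩).QQ_nonneg f g
    have b := (QF.avg A hqo).QQ_nonneg f g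
    by_cases hyA : y ∈ ⋃ i ∈ A, O n i
    · simp only [Set.mem_iUnion] at hyA
      obtain ⟨i, hi, hyi⟩ := hyA
      refine ho i g ?_ y hyi
      refine (QQ_avg A hqo f g hi).trans_lt (lt_of_lt_of_le ?_ (h2 i hi))
      have h5 := h4.trans_le (min_le_right _ _)
      rw [lt_div_iff₀ (by positivity)] at h5
      nlinarith
    · refine h1 g ?_ hx y ⟨hy.1, ?_⟩
      · have h5 := h4.trans_le (min_le_left _ _)
        linarith
      · rintro (h | h)
        · exact hy.2 h
        · exact hyA h

section Selection
variable {L : Set K} {x : K} {N O : ℕ → ι → Set K}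

lemma cset_closed (hL : IsClosed L) (hO : ∀ n i, IsOpen (O n i)) (p : List ℕ) {R : Set K}
    (hR : IsOpen R) : IsClosed (cset L N O p R) := by
  cases p with
  | nil => exact hL.sdiff hR
  | cons n p => exact isClosed_closure.sdiff (isOpen_iUnion fun i => hO n i)

lemma cset_anti (p : List ℕ) {R R' : Set K} (h : R ⊆ R') :
    cset L N O p R' ⊆ cset L N O p R := by
  induction p with
  | nil => exact Set.diff_subset_diff_right h
  | cons n p ih =>
    exact Set.diff_subset_diff_left (closure_mono (Set.inter_subset_inter_left _ ih))

lemma cset_cons_subset (hL : IsClosed L) (hO : ∀ n i, IsOpen (O n i)) (n : ℕ) (p : List ℕ)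
    {R : Set K} (hR : IsOpen R) : cset L N O (n :: p) R ⊆ cset L N O p R := fun y hy =>
  closure_minimal Set.inter_subset_left (cset_closed hL hO p hR) hy.1

lemma cset_subset (hL : IsClosed L) (hO : ∀ n i, IsOpen (O n i)) (p : List ℕ)
    {R : Set K} (hR : IsOpen R) : cset L N O p R ⊆ L \ R := by
  induction p with
  | nil => exact subset_rfl
  | cons n p ih => exact (cset_cons_subset hL hO n p hR).trans ih

/-- one selection step -/
def SStep (L : Set K) (x : K) (N O : ℕ → ι → Set K) (f : C(K, ℝ)) (R R' : Set K) : Prop :=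
  ∃ p n, ∃ A : Finset ι, Sel L x N O f p n A R ∧ R' = R ∪ ⋃ i ∈ A, O n i

lemma SStep.star_props (hO : ∀ n i, IsOpen (O n i)) {f : C(K, ℝ)} {R R' : Set K}
    (h : Relation.ReflTransGen (SStep L x N O f) R R') (hR : IsOpen R) :
    IsOpen R' ∧ R ⊆ R' := by
  induction h with
  | refl => exact ⟨hR, subset_rfl⟩
  | tail _ h ih =>
    obtain ⟨p, n, A, _, rfl⟩ := h
    exact ⟨ih.1.union (isOpen_biUnion fun i _ => hO n i), ih.2.trans Set.subset_union_left⟩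

lemma reach_of_star {f : C(K, ℝ)} {ε : ℝ} {R R' : Set K}
    (h : Relation.ReflTransGen (SStep L x N O f) R R')
    (hR' : ∀ y ∈ L \ R', |f y - f x| ≤ 2 * ε) : ∃ s, Reach L x N O f ε s R := by
  induction h using Relation.ReflTransGen.head_induction_on with
  | refl => exact ⟨[], hR'⟩
  | head h _ ih =>
    obtain ⟨p, n, A, hA, rfl⟩ := h
    obtain ⟨s, hs⟩ := ih
    exact ⟨(p, n, A.card) :: s, A, rfl, hA, hs⟩

lemma select_one (hL : IsClosed L) (hO : ∀ n i, IsOpen (O n i)) (hNO : ∀ n i, N n i ⊆ O n i)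
    (hdis : ∀ n i j, ∀ y, y ∈ O n i → y ∈ N n j → i = j) {f : C(K, ℝ)} {ε : ℝ} (hε : 0 < ε)
    {H : Set K} (hH : H = {y | 2 * ε ≤ |f y - f x|}) {p : List ℕ} {n : ℕ} {R : Set K}
    (hR : IsOpen R) (hdisj : ∀ y ∈ cset L N O (n :: p) R, y ∉ H) :
    ∃ A : Finset ι, Sel L x N O f p n A R ∧
      ∀ y ∈ cset L N O p R, y ∈ H → y ∈ ⋃ i, N n i → y ∈ ⋃ i ∈ A, O n i := by
  classical
  have hHmem : ∀ y, y ∈ H ↔ ε ^ 2 ≤ (f y - f x) ^ 2 / 4 := by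
    intro y
    rw [hH, Set.mem_ofPred_eq]
    constructor
    · intro h
      have : (2 * ε) ^ 2 ≤ |f y - f x| ^ 2 := by gcongr
      rw [sq_abs] at this; linarith
    · intro h
      apply le_of_sq_le_sq _ (abs_nonneg _)
      rw [sq_abs]; linarith
  have hHc : IsClosed H := by
    rw [hH]; exact isClosed_le (by fun_prop) (by fun_prop)
  set E := cset L N O p R with hE
  have hMc : IsCompact (closure (E ∩ ⋃ i, N n i) ∩ H) := (isClosed_closure.inter hHc).isCompact
  obtain ⟨A₀, hA₀⟩ := hMc.elim_finite_subcover (fun i => O n i) (hO n) (by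
    rintro y ⟨hy, hyH⟩
    by_contra hnot
    exact hdisj y ⟨hy, hnot⟩ hyH)
  let A := A₀.filter (fun i => ε ^ 2 ≤ osc x (E ∩ N n i) f)
  have hcov : ∀ y ∈ E, y ∈ H → ∀ i, y ∈ N n i → i ∈ A := by
    intro y hyE hyH i hi
    have hyM : y ∈ closure (E ∩ ⋃ i, N n i) ∩ H :=
      ⟨subset_closure ⟨hyE, Set.mem_iUnion.2 ⟨i, hi⟩⟩, hyH⟩
    have := hA₀ hyM
    simp only [Set.mem_iUnion] at this
    obtain ⟨j, hj, hyj⟩ := this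
    obtain rfl := hdis n j i y hyj hi
    exact Finset.mem_filter.2 ⟨hj, ((hHmem y).1 hyH).trans (le_osc x f ⟨hyE, hi⟩)⟩
  refine ⟨A, ?_, ?_⟩
  · let G : Set K := closure (⋃ i ∈ {i | i ∉ A}, E ∩ N n i)
    have hG : ∀ y ∈ G, (f y - f x) ^ 2 / 4 < ε ^ 2 := by
      intro y hy
      by_contra! hcon
      have hyH := (hHmem y).2 hcon
      have hyM : y ∈ closure (E ∩ ⋃ i, N n i) ∩ H := by
        refine ⟨closure_mono ?_ hy, hyH⟩
        intro z hz
        simp only [Set.mem_iUnion] at hz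
        obtain ⟨i, _, hz⟩ := hz
        exact ⟨hz.1, Set.mem_iUnion.2 ⟨i, hz.2⟩⟩
      have := hA₀ hyM
      simp only [Set.mem_iUnion] at this
      obtain ⟨j, hj, hyj⟩ := this
      have key : ∀ z, z ∈ O n j ∩ (⋃ i ∈ {i | i ∉ A}, E ∩ N n i) → j ∉ A ∧ z ∈ E ∩ N n j := by
        rintro z ⟨hz1, hz2⟩
        simp only [Set.mem_iUnion] at hz2
        obtain ⟨i, hi, hz⟩ := hz2
        obtain rfl := hdis n j i z hz1 hz.2
        exact ⟨hi, hz⟩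
      have hy2 : y ∈ closure (O n j ∩ (⋃ i ∈ {i | i ∉ A}, E ∩ N n i)) :=
        (hO n j).inter_closure ⟨hyj, hy⟩
      have hjA : j ∉ A := by
        obtain ⟨z, hz⟩ := closure_nonempty_iff.1 ⟨y, hy2⟩
        exact (key z hz).1
      have hy3 : y ∈ closure (E ∩ N n j) := closure_mono (fun z hz => (key z hz).2) hy2
      exact hjA (Finset.mem_filter.2 ⟨hj, hcon.trans (le_osc_closure x f hy3)⟩)
    obtain ⟨t, ht0, htε, ht⟩ : ∃ t, 0 ≤ t ∧ t < ε ^ 2 ∧ ∀ y ∈ G, (f y - f x) ^ 2 / 4 ≤ t := by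
      rcases G.eq_empty_or_nonempty with h | h
      · exact ⟨0, le_rfl, by positivity, fun y hy => by rw [h] at hy; exact hy.elim⟩
      · obtain ⟨y, hy, hmax⟩ := (isClosed_closure.isCompact : IsCompact G).exists_isMaxOn h
          (f := fun y => (f y - f x) ^ 2 / 4) (by fun_prop)
        exact ⟨_, by positivity, hG y hy, fun z hz => hmax hz⟩
    refine ⟨t, ε ^ 2, htε, fun i hi => (Finset.mem_filter.1 hi).2, fun i hi => ?_⟩
    refine osc_le x f ht0 fun y hy => ht y (subset_closure ?_)
    exact Set.mem_biUnion (show i ∈ {i | i ∉ A} from hi) hy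
  · intro y hyE hyH hyN
    obtain ⟨i, hi⟩ := Set.mem_iUnion.1 hyN
    exact Set.mem_biUnion (show i ∈ A from hcov y hyE hyH i hi) (hNO n i hi)

/-- failing state of the search -/
def Bad (L : Set K) (x : K) (N O : ℕ → ι → Set K) (f : C(K, ℝ)) (H : Set K) (j : ℕ)
    (st : List ℕ × Set K) : Prop :=
  IsOpen st.2 ∧ (∀ i < j, ∀ y ∈ cset L N O st.1 st.2, y ∈ H → y ∉ ⋃ a, N i a) ∧
    ¬ ∃ R', Relation.ReflTransGen (SStep L x N O f) st.2 R' ∧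
      ∀ y ∈ cset L N O st.1 R', y ∉ H

lemma bad_step (hL : IsClosed L) (hO : ∀ n i, IsOpen (O n i)) (hNO : ∀ n i, N n i ⊆ O n i)
    (hdis : ∀ n i j, ∀ y, y ∈ O n i → y ∈ N n j → i = j) {f : C(K, ℝ)} {ε : ℝ} (hε : 0 < ε)
    {H : Set K} (hH : H = {y | 2 * ε ≤ |f y - f x|}) {j : ℕ} {st : List ℕ × Set K}
    (hb : Bad L x N O f H j st) :
    ∃ st', Bad L x N O f H (j + 1) st' ∧ cset L N O st'.1 st'.2 ⊆ cset L N O st.1 st.2 := by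
  obtain ⟨p, R⟩ := st
  obtain ⟨hR, hlt, hfail⟩ := hb
  simp only at hR hlt hfail
  by_cases h1 : Bad L x N O f H (j + 1) (j :: p, R)
  · exact ⟨_, h1, cset_cons_subset hL hO j p hR⟩
  have h2 : ∃ R', Relation.ReflTransGen (SStep L x N O f) R R' ∧
      ∀ y ∈ cset L N O (j :: p) R', y ∉ H := by
    by_contra hcon
    refine h1 ⟨hR, fun i hi y hy hyH hyN => ?_, hcon⟩
    rcases Nat.lt_succ_iff_lt_or_eq.1 hi with hi | rfl
    · exact hlt i hi y (cset_cons_subset hL hO j p hR hy) hyH hyN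
    · obtain ⟨a, ha⟩ := Set.mem_iUnion.1 hyN
      exact hy.2 (Set.mem_iUnion.2 ⟨a, hNO _ a ha⟩)
  obtain ⟨R₁, hstar, hR₁⟩ := h2
  obtain ⟨hR₁o, hRR₁⟩ := SStep.star_props hO hstar hR
  obtain ⟨A, hsel, hcov⟩ := select_one hL hO hNO hdis hε hH hR₁o hR₁
  have hstar2 : Relation.ReflTransGen (SStep L x N O f) R (R₁ ∪ ⋃ i ∈ A, O j i) :=
    hstar.tail ⟨p, j, A, hsel, rfl⟩
  obtain ⟨hR₂o, hRR₂⟩ := SStep.star_props hO hstar2 hR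
  refine ⟨(p, R₁ ∪ ⋃ i ∈ A, O j i), ⟨hR₂o, fun i hi y hy hyH hyN => ?_, ?_⟩, cset_anti p hRR₂⟩
  · rcases Nat.lt_succ_iff_lt_or_eq.1 hi with hi | rfl
    · exact hlt i hi y (cset_anti p hRR₂ hy) hyH hyN
    · have := hcov y (cset_anti p Set.subset_union_left hy) hyH hyN
      exact (cset_subset hL hO p hR₂o hy).2 (Or.inr this)
  · rintro ⟨R', hs, hd⟩
    exact hfail ⟨R', hstar2.trans hs, hd⟩

lemma exists_reach (hL : IsClosed L) (hO : ∀ n i, IsOpen (O n i)) (hNO : ∀ n i, N n i ⊆ O n i)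
    (hdis : ∀ n i j, ∀ y, y ∈ O n i → y ∈ N n j → i = j) {f : C(K, ℝ)} {ε : ℝ} (hε : 0 < ε)
    (hcover : ∀ y ∈ L, 2 * ε ≤ |f y - f x| → ∃ n i, y ∈ N n i) :
    ∃ s, Reach L x N O f ε s ∅ := by
  obtain ⟨H, hH⟩ : ∃ H : Set K, H = {y | 2 * ε ≤ |f y - f x|} := ⟨_, rfl⟩
  have hHc : IsClosed H := by
    rw [hH]; exact isClosed_le (by fun_prop) (by fun_prop)
  by_cases hbad : Bad L x N O f H 0 ([], ∅)
  · exfalso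
    choose! nxt hn1 hn2 using fun (j : ℕ) (st : List ℕ × Set K) (h : Bad L x N O f H j st) =>
      bad_step hL hO hNO hdis hε hH h
    let sq : ℕ → List ℕ × Set K := fun j => Nat.rec ([], ∅) (fun j st => nxt j st) j
    have hsq : ∀ j, Bad L x N O f H j (sq j) := by
      intro j
      induction j with
      | zero => exact hbad
      | succ j ih => exact hn1 j _ ih
    have hcl : ∀ j, IsClosed (cset L N O (sq j).1 (sq j).2 ∩ H) := fun j =>
      (cset_closed hL hO _ (hsq j).1).inter hHc
    obtain ⟨y, hy⟩ := IsCompact.nonempty_iInter_of_sequence_nonempty_isCompact_isClosed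
      (fun j => cset L N O (sq j).1 (sq j).2 ∩ H)
      (fun j => Set.inter_subset_inter_left _ (hn2 j _ (hsq j)))
      (fun j => by
        by_contra hcon
        exact (hsq j).2.2 ⟨_, Relation.ReflTransGen.refl, fun y hy hyH => hcon ⟨y, hy, hyH⟩⟩)
      (hcl 0).isCompact hcl
    rw [Set.mem_iInter] at hy
    have hyL : y ∈ L := (cset_subset hL hO _ (hsq 0).1 (hy 0).1).1
    have hyH : y ∈ H := (hy 0).2
    obtain ⟨n, i, hi⟩ := hcover y hyL (by rw [hH] at hyH; exact hyH)
    exact (hsq (n + 1)).2.1 n (Nat.lt_succ_self n) y (hy (n + 1)).1 hyH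
      (Set.mem_iUnion.2 ⟨i, hi⟩)
  · have : ∃ R', Relation.ReflTransGen (SStep L x N O f) ∅ R' ∧
        ∀ y ∈ cset L N O [] R', y ∉ H := by
      by_contra hcon
      exact hbad ⟨isOpen_empty, fun i hi => absurd hi (Nat.not_lt_zero i), hcon⟩
    obtain ⟨R', hs, hd⟩ := this
    refine reach_of_star hs fun y hy => ?_
    have := hd y hy
    rw [hH, Set.mem_ofPred_eq, not_le] at this
    exact this.le

end Selection

lemma good_step (Mod : ℝ → C(K, ℝ) → Prop) {L : Set K} {x : K} (hxL : x ∈ L) (hL : IsClosed L)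
    {N O : ℕ → ι → Set K} (hO : ∀ n i, IsOpen (O n i)) (hNO : ∀ n i, N n i ⊆ O n i)
    (hdis : ∀ n i j, ∀ y, y ∈ O n i → y ∈ N n j → i = j) (hgood : ∀ n i, Good Mod (O n i))
    (hcover : ∀ ε > 0, ∀ f, Mod ε f → ∀ y ∈ L, 2 * ε ≤ |f y - f x| → ∃ n i, y ∈ N n i) :
    Good Mod L := by
  choose q hq hq' using fun s => programForm Mod L x N O hgood s ∅
  obtain ⟨e, he⟩ := exists_surjective_nat (List (List ℕ × ℕ × ℕ))
  have hw : QF (wsum fun n => q (e n)) := QF.wsum fun n => hq (e n)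
  refine ⟨_, hw.add (s := 1/2) (t := 1/2) (QF.eval x) (by norm_num) (by norm_num) (by norm_num),
    fun ε hε f hf => ?_⟩
  obtain ⟨s, hs⟩ := exists_reach hL hO hNO hdis hε (hcover ε hε f hf)
  obtain ⟨n, rfl⟩ := he s
  obtain ⟨δ, hδ, h⟩ := hq' (e n) ε hε f hf hs
  refine ⟨min (δ / 2 ^ (n + 1) / 2) (ε ^ 2 / 32), by positivity, fun g hg y hy => ?_⟩
  rw [QQ_add] at hg
  have a := hw.QQ_nonneg f g
  have b := (QF.eval x).QQ_nonneg f g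
  have c := hg.trans_le (min_le_left _ _)
  have d := hg.trans_le (min_le_right _ _)
  refine h g ?_ ?_ y ⟨hy, Set.notMem_empty y⟩
  · refine (QQ_wsum (fun n => hq (e n)) f g n).trans_lt ?_
    have : QQ (wsum fun n => q (e n)) f g < δ / 2 ^ (n + 1) := by linarith
    rwa [lt_div_iff₀ (by positivity), mul_comm] at this
  · have e1 : QQ (fun f : C(K, ℝ) => (f x) ^ 2) f g = (f x - g x) ^ 2 / 4 := by
      unfold QQ; simp; ring
    rw [e1] at d
    apply abs_le_of_sq_le_sq _ (by positivity)
    nlinarith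

end Main

lemma all_good {K : Type*} [TopologicalSpace K] [CompactSpace K] [T2Space K]
    (hdesc : DescriptiveCompact K) (rel : K → K → Prop)
    (hfrag : ∀ Z : Set K, IsClosed Z → Z.Nonempty → ∃ U, IsOpen U ∧ (Z ∩ U).Nonempty ∧
        ∀ t ∈ Z ∩ U, ∀ u ∈ Z ∩ U, rel t u) :
    Good (fun ε f => ∀ t u, rel t u → |f t - f u| ≤ ε) (Set.univ : Set K) := by
  set Mod : ℝ → C(K, ℝ) → Prop := fun ε f => ∀ t u, rel t u → |f t - f u| ≤ ε with hMod
  let W : Set K := {y | ∃ V, IsOpen V ∧ y ∈ V ∧ Good Mod V}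
  have hWo : IsOpen W := by
    rw [isOpen_iff_forall_mem_open]
    rintro y ⟨V, hV, hy, hG⟩
    exact ⟨V, fun z hz => ⟨V, hV, hz, hG⟩, hV, hy⟩
  have hW : W = Set.univ := by
    by_contra hne
    obtain ⟨U, hU, ⟨x, hxW, hxU⟩, hdiam⟩ := hfrag Wᶜ hWo.isClosed_compl
      (Set.nonempty_compl.2 hne)
    obtain ⟨L, hLx, hLc, hLU⟩ := exists_mem_nhds_isClosed_subset (hU.mem_nhds hxU)
    choose V hV hyV hVG using fun y : W => y.2
    obtain ⟨N, O, hO, hOV, hNO, hdis, hcov⟩ := descriptive_refine hdesc V hV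
    have hgood : Good Mod L := by
      refine good_step Mod (mem_of_mem_nhds hLx) hLc hO hNO hdis
        (fun n i => (hVG i).mono (hOV n i)) ?_
      intro ε hε f hf y hy hfy
      have hyW : y ∈ W := by
        by_contra hnot
        have := hf y x (hdiam y ⟨hnot, hLU hy⟩ x ⟨hxW, hxU⟩)
        linarith
      exact hcov ⟨y, hyW⟩ y (hyV ⟨y, hyW⟩)
    exact hxW ⟨interior L, isOpen_interior, mem_interior_iff_mem_nhds.2 hLx,
      hgood.mono interior_subset⟩
  refine isCompact_univ.induction_on (p := fun S => Good Mod S) (Good.empty Mod)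
    (fun s t hst ht => ht.mono hst) (fun s t hs ht => hs.union ht) ?_
  intro y _
  obtain ⟨V, hV, hy, hG⟩ : y ∈ W := by rw [hW]; trivial
  exact ⟨V, mem_nhdsWithin_of_mem_nhds (hV.mem_nhds hy), hG⟩

/-- Theorem D: if `K` is a descriptive compact Hausdorff space which is a continuous
image of a Radon–Nikodym compact, then `C(K)` admits an equivalent LUR norm. -/
theorem theoremD {K : Type u} [TopologicalSpace K] [CompactSpace K] [T2Space K]
    (hdesc : DescriptiveCompact K)
    (himage : ∃ (K' : Type u) (_ : TopologicalSpace K') (_ : CompactSpace K')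
      (_ : T2Space K'), RadonNikodymCompact K' ∧
        ∃ π : K' → K, Continuous π ∧ Function.Surjective π) :
    ∃ N : C(K, ℝ) → ℝ, IsNorm N ∧
      (∃ c C : ℝ, 0 < c ∧ c ≤ C ∧ ∀ f : C(K, ℝ), c * ‖f‖ ≤ N f ∧ N f ≤ C * ‖f‖) ∧
      ∀ f : C(K, ℝ), LURAt N f := by
  obtain ⟨rel, hfrag, hmod⟩ := image_interface himage
  choose q hq hq' using fun k => all_good hdesc (rel k) (hfrag k)
  have hw : QF (wsum q) := QF.wsum hq
  have hn : QF (fun f : C(K, ℝ) => ‖f‖ ^ 2) := QF.norm_sq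
  have hF := hn.add (s := 1/2) (t := 1/2) hw (by norm_num) (by norm_num) (by norm_num)
  set F : C(K, ℝ) → ℝ := fun f => (1/2) * ‖f‖ ^ 2 + (1/2) * wsum q f with hFdef
  have hlow : ∀ f, (1/2) * ‖f‖ ≤ √(F f) := fun f => by
    apply Real.le_sqrt_of_sq_le
    have h1 := hw.nonneg f
    have h2 := sq_nonneg ‖f‖
    simp only [hFdef]
    nlinarith
  have hup : ∀ f, √(F f) ≤ ‖f‖ := fun f => by
    rw [Real.sqrt_le_left (norm_nonneg f)]
    exact hF.bdd f
  refine ⟨fun f => √(F f), ⟨fun z => Real.sqrt_nonneg _, fun z hz => ?_, hF.sqrt_smul,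
    hF.sqrt_add⟩, ⟨1/2, 1, by norm_num, by norm_num, fun f => ⟨hlow f, by simpa using hup f⟩⟩, ?_⟩
  · have h1 := hlow z
    simp only at hz
    rw [hz] at h1
    exact norm_le_zero_iff.1 (by linarith)
  · intro f fr hfr
    have hQ : Tendsto (fun r => QQ F f (fr r)) atTop (𝓝 0) := by
      refine hfr.congr fun r => ?_
      simp only [Real.sq_sqrt (hF.nonneg _)]
      rfl
    rw [Metric.tendsto_atTop]
    intro ε hε
    obtain ⟨k, hk⟩ := hmod f (ε / 10) (by positivity)
    obtain ⟨δ, hδ, h⟩ := hq' k (ε / 10) (by positivity) f hk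
    have hev := hQ.eventually (gt_mem_nhds (show 0 < δ / 2 ^ (k + 1) / 2 by positivity))
    obtain ⟨r₀, hr₀⟩ := eventually_atTop.1 hev
    refine ⟨r₀, fun r hr => ?_⟩
    have h1 := hr₀ r hr
    rw [hFdef, QQ_add] at h1
    have h2 := hn.QQ_nonneg f (fr r)
    have h3 : QQ (wsum q) f (fr r) < δ / 2 ^ (k + 1) := by linarith
    rw [lt_div_iff₀ (by positivity), mul_comm] at h3
    have h4 := h (fr r) ((QQ_wsum hq f (fr r) k).trans_lt h3)
    have h5 : ‖f - fr r‖ ≤ 5 * (ε / 10) :=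
      (ContinuousMap.norm_le _ (by positivity)).2 fun y => h4 y trivial
    rw [Real.dist_eq, sub_zero, abs_of_nonneg (Real.sqrt_nonneg _)]
    linarith [hup (f - fr r)]
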